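/- arXiv:math/0305393 — 2 statements merged into one kernel-verified Lean document; each statement's English description precedes it below -/
import Mathlib

section
/- For all positive integers q, n and every integer k ≥ 1, #{π ∈ S_{n+q−1} : #Del_q(π) = k−1} = q^k · (q−1)! · c(n,k). -/
open Finset

/-- The Coxeter generator `s_j = (j, j+1)` of the symmetric group on `{1,…,m}`,
viewed as a permutation of `ℕ` (with 1-based positions). -/
def sgen (j : ℕ) : Equiv.Perm ℕ := Equiv.swap j (j + 1)

/-- The permutation determined by a word in the Coxeter generators,
letters read from left to right and composed as functions. -/
def wordPerm (L : List ℕ) : Equiv.Perm ℕ := (L.map sgen).prod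

/-- The canonical presentation of a permutation of `{1,…,m}` (given as a permutation of `ℕ`
supported on `{1,…,m}`): the unique factorization `w = w₁ w₂ ⋯ w_{m-1}` with
`w_j ∈ R_j = {1, s_j, s_j s_{j-1}, …, s_j ⋯ s_1}`, recorded as the list of indices of the
Coxeter generators appearing, read from left to right. -/
def canonWord : ℕ → Equiv.Perm ℕ → List ℕ
  | 0, _ => []
  | m + 1, π =>
      canonWord m
          (π * (wordPerm ((List.range' (π⁻¹ (m + 1)) (m + 1 - π⁻¹ (m + 1))).reverse))⁻¹)
        ++ (List.range' (π⁻¹ (m + 1)) (m + 1 - π⁻¹ (m + 1))).reverse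

def finIccEquiv (m : ℕ) : Fin m ≃ {i : ℕ // i ∈ Finset.Icc 1 m} where
  toFun a := ⟨a.1 + 1, by have := a.isLt; simp only [Finset.mem_Icc]; omega⟩
  invFun b := ⟨b.1 - 1, by have := b.2; simp only [Finset.mem_Icc] at this; omega⟩
  left_inv a := by ext; simp
  right_inv b := by
    have := b.2
    simp only [Finset.mem_Icc] at this
    ext
    simp only []
    omega

/-- A permutation of `{1,…,m}`, i.e. of `Fin m`, viewed as a permutation of `ℕ`
(moving only the points `1,…,m`, with `i ∈ Fin m` corresponding to the point `i+1`). -/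
def natPerm {m : ℕ} (π : Equiv.Perm (Fin m)) : Equiv.Perm ℕ :=
  π.extendDomain (finIccEquiv m)

/-- `Del_q` of a permutation of `{1,…,m}`: the set of positions `q+1 ≤ i ≤ m` that are
`(q-1)`-st almost left-to-right minima, i.e. `#{j < i : π(j) < π(i)} ≤ q - 1`. -/
def DelQ (q m : ℕ) (π : Equiv.Perm ℕ) : Finset ℕ :=
  (Finset.Icc (q + 1) m).filter fun i =>
    ((Finset.Ico 1 i).filter fun j => π j < π i).card ≤ q - 1

/-- The descent set of a permutation of `{1,…,m}`: positions `1 ≤ i ≤ m-1` with `π(i) > π(i+1)`. -/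
def DesSet (m : ℕ) (π : Equiv.Perm ℕ) : Finset ℕ :=
  (Finset.Icc 1 (m - 1)).filter fun i => π (i + 1) < π i

/-- `Des_q(π) = (Des(π) ∩ {q,…,m-1}) ∪ (Del_q(π) - 1)`. -/
def DesQ (q m : ℕ) (π : Equiv.Perm ℕ) : Finset ℕ :=
  DesSet m π ∩ Finset.Icc q (m - 1) ∪ (DelQ q m π).image (fun i => i - 1)

/-- The `q`-inversion number of a permutation of `{1,…,m}`:
`inv_q(π) = Σ_{i=q+1}^m min(i-q, #{j < i : π(j) > π(i)})`. -/
def invQ (q m : ℕ) (π : Equiv.Perm ℕ) : ℕ :=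
  ∑ i ∈ Finset.Icc (q + 1) m,
    min (i - q) ((Finset.Ico 1 i).filter fun j => π i < π j).card

/-- The `q`-reverse major index `rmaj_{q,m}(π) = Σ_{i ∈ Des_q(π)} (m - i)`. -/
def rmajQ (q m : ℕ) (π : Equiv.Perm ℕ) : ℕ :=
  ∑ i ∈ DesQ q m π, (m - i)

/-- The `q`-length of a permutation of `{1,…,m}`: the number of letters in the canonical
presentation, where the generators `s_1, …, s_{q-1}` are not counted. -/
def ellQ (q m : ℕ) (π : Equiv.Perm ℕ) : ℕ :=
  ((canonWord m π).filter fun j => q ≤ j).length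

/-- `del_q` of a permutation of `{1,…,m}`: the number of occurrences of the generator `s_q`
in the canonical presentation. -/
def delq (q m : ℕ) (π : Equiv.Perm ℕ) : ℕ := (canonWord m π).count q

/-- The covering map `f_q : S_m → S_{m-q+1}`, defined on the canonical presentation by
`s_j ↦ 1` if `j ≤ q-1` and `s_j ↦ s_{j-q+1}` if `j ≥ q`. -/
def fq (q m : ℕ) (π : Equiv.Perm ℕ) : Equiv.Perm ℕ :=
  wordPerm (((canonWord m π).filter fun j => q ≤ j).map fun j => j - q + 1)

/-- A permutation of `{1,…,m}` avoids the pattern set `Pat(q)` iff there is no sequence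
`1 ≤ i₁ < i₂ < ⋯ < i_{q+1} < m` with `π(i_{q+1}) > π(i_{q+1}+1)` and
`π(i_j) < π(i_{q+1}+1)` for all `1 ≤ j ≤ q`. -/
def AvoidsPat (q m : ℕ) (π : Equiv.Perm ℕ) : Prop :=
  ¬ ∃ f : Fin (q + 1) → ℕ, StrictMono f ∧ 1 ≤ f 0 ∧ f (Fin.last q) < m ∧
      π (f (Fin.last q) + 1) < π (f (Fin.last q)) ∧
      ∀ a : Fin (q + 1), a ≠ Fin.last q → π (f a) < π (f (Fin.last q) + 1)

/-- The Stirling number of the second kind `S(n,k)`: the number of partitions of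
`{1,…,n}` into `k` nonempty blocks. -/
noncomputable def stirling2 (n k : ℕ) : ℕ :=
  Nat.card {P : Finpartition (Finset.univ : Finset (Fin n)) // P.parts.card = k}

/-- The `q`-Bell number `b_q(n) = Σ_k q^k S(n,k)`. -/
noncomputable def qBell (q n : ℕ) : ℕ := ∑ k ∈ Finset.range (n + 1), q ^ k * stirling2 n k

/-- `h_q(m)`: the number of permutations of `{1,…,m}` avoiding all patterns in `Pat(q)`. -/
noncomputable def hq (q m : ℕ) : ℕ :=
  Nat.card {π : Equiv.Perm (Fin m) // AvoidsPat q m (natPerm π)}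

/-- The number of cycles (including fixed points) of a permutation of `{1,…,n}`. -/
def cycleCount {n : ℕ} (σ : Equiv.Perm (Fin n)) : ℕ :=
  σ.cycleType.card + (n - σ.support.card)

/-- The signless Stirling number of the first kind `c(n,k)`: the number of permutations
of `{1,…,n}` with exactly `k` cycles. -/
noncomputable def stirling1 (n k : ℕ) : ℕ :=
  Nat.card {σ : Equiv.Perm (Fin n) // cycleCount σ = k}

namespace Equiv.Perm

theorem cycleType_swap_mul {α : Type*} [Fintype α] [DecidableEq α] {g : Perm α} {z : α}
    (hz : g z ≠ z) :
    (swap z (g z) * g).cycleType.card + g.cycleType.sum =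
      g.cycleType.card + (swap z (g z) * g).cycleType.sum + 1 := by
  set c := g.cycleOf z with hc
  have hcyc : c.IsCycle := isCycle_cycleOf g hz
  have hcz : c z = g z := cycleOf_apply_self g z
  set r := g * c⁻¹ with hr
  have hdisj : Disjoint r c := disjoint_mul_inv_of_mem_cycleFactorsFinset
    (cycleOf_mem_cycleFactorsFinset_iff.2 (mem_support.2 hz))
  have hg : g = c * r := by
    rw [← hdisj.commute.eq, hr, inv_mul_cancel_right]
  have hsupp : (swap z (c z) * c).support ⊆ c.support := by
    intro y hy
    exact (mem_support_swap_mul_imp_mem_support_ne hy).1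
  have hdisj' : Disjoint (swap z (c z) * c) r :=
    (disjoint_iff_disjoint_support.2
      (Finset.disjoint_of_subset_left hsupp (disjoint_iff_disjoint_support.1 hdisj.symm)))
  have hprod : swap z (g z) * g = (swap z (c z) * c) * r := by
    rw [mul_assoc, ← hg, hcz]
  have key : (swap z (c z) * c).cycleType.card + c.cycleType.sum =
      c.cycleType.card + (swap z (c z) * c).cycleType.sum + 1 := by
    have hcz' : c z ≠ z := hcz ▸ hz
    by_cases h : c (c z) = z
    · have hs : c = swap z (c z) := hcyc.eq_swap_of_apply_apply_eq_self hcz' h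
      have h1 : swap z (c z) * c = 1 := by
        nth_rewrite 2 [hs]
        exact swap_mul_self _ _
      have h2 : c.cycleType.sum = 2 := by
        rw [sum_cycleType, hs, card_support_swap hcz'.symm]
      rw [h1, h2, card_cycleType_eq_one.2 hcyc]
      simp
    · have h1 := hcyc.swap_mul hcz' h
      rw [card_cycleType_eq_one.2 hcyc, card_cycleType_eq_one.2 h1, sum_cycleType, sum_cycleType,
        support_swap_mul_eq _ _ h, Finset.sdiff_singleton_eq_erase,
        Finset.card_erase_of_mem (mem_support.2 hcz')]
      have := Finset.card_pos.2 ⟨z, mem_support.2 hcz'⟩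
      omega
  have hgc : g.cycleType = c.cycleType + r.cycleType := by
    conv_lhs => rw [hg, hdisj.symm.cycleType_mul]
  rw [hprod, hdisj'.cycleType_mul, hgc]
  simp only [Multiset.card_add, Multiset.sum_add]
  omega

theorem decomposeFin_symm_eq_swap_mul {n : ℕ} (p : Fin (n + 1)) (e : Perm (Fin n)) :
    decomposeFin.symm (p, e) = swap 0 p * decomposeFin.symm (0, e) := by
  ext i
  refine Fin.cases ?_ (fun i => ?_) i <;> simp

theorem cycleType_decomposeFin_symm_zero {n : ℕ} (e : Perm (Fin n)) :
    (decomposeFin.symm (0, e)).cycleType = e.cycleType := by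
  rw [← cycleType_extendDomain (finSuccAboveEquiv (0 : Fin (n + 1)))]
  congr 1
  ext i
  refine Fin.cases ?_ (fun i => ?_) i
  · rw [extendDomain_apply_not_subtype _ _ (by simp)]
    simp
  · have := extendDomain_apply_image e (finSuccAboveEquiv (0 : Fin (n + 1))) i
    simp only [finSuccAboveEquiv_apply, Fin.zero_succAbove] at this
    rw [this]
    simp

/-- The permutation with last value `p` whose other values are ordered as those of `e`. -/
def snocLast {n : ℕ} (p : Fin (n + 1)) (e : Perm (Fin n)) : Perm (Fin (n + 1)) :=
  (finSuccEquivLast.trans e.optionCongr).trans (finSuccEquiv' p).symm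

@[simp]
theorem snocLast_last {n : ℕ} (p : Fin (n + 1)) (e : Perm (Fin n)) :
    snocLast p e (Fin.last n) = p := by
  simp [snocLast]

@[simp]
theorem snocLast_castSucc {n : ℕ} (p : Fin (n + 1)) (e : Perm (Fin n)) (i : Fin n) :
    snocLast p e i.castSucc = p.succAbove (e i) := by
  simp [snocLast]

theorem snocLast_bijective (n : ℕ) :
    Function.Bijective fun x : Fin (n + 1) × Perm (Fin n) => snocLast x.1 x.2 := by
  rw [Fintype.bijective_iff_injective_and_card]
  constructor
  · rintro ⟨p, e⟩ ⟨p', e'⟩ h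
    simp only at h
    have hp : p = p' := by simpa using DFunLike.congr_fun h (Fin.last n)
    subst hp
    have he : e = e' := by
      ext i
      have := DFunLike.congr_fun h i.castSucc
      simp only [snocLast_castSucc, Fin.succAbove_right_inj] at this
      rw [this]
    rw [he]
  · simp [Fintype.card_perm, Nat.factorial_succ]

/-- The number of `(q-1)`-st almost left-to-right minima of `π` among the positions `i ≥ q`,
with positions counted from `0`. -/
def almostMinCount (q : ℕ) {m : ℕ} (π : Perm (Fin m)) : ℕ :=
  #{i : Fin m | q ≤ i ∧ #{j : Fin m | j < i ∧ π j < π i} < q}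

theorem almostMinCount_snocLast (q : ℕ) {m : ℕ} (p : Fin (m + 1)) (e : Perm (Fin m)) :
    almostMinCount q (snocLast p e) =
      almostMinCount q e + if q ≤ m ∧ (p : ℕ) < q then 1 else 0 := by
  have hcast (i : Fin m) :
      #{j : Fin (m + 1) | j < i.castSucc ∧ snocLast p e j < snocLast p e i.castSucc} =
        #{j : Fin m | j < i ∧ e j < e i} := by
    simp only [Finset.card_filter, Fin.sum_univ_castSucc, snocLast_castSucc,
      Fin.castSucc_lt_castSucc_iff, Fin.succAbove_lt_succAbove_iff]
    simp [Fin.le_last, not_lt_of_ge]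
  have hlast : #{j : Fin (m + 1) | j < Fin.last m ∧ snocLast p e j < snocLast p e (Fin.last m)} =
      (p : ℕ) := by
    simp only [Finset.card_filter, Fin.sum_univ_castSucc, snocLast_castSucc, snocLast_last,
      Fin.castSucc_lt_last, true_and, lt_irrefl, false_and, if_false, add_zero,
      Fin.succAbove_lt_iff_castSucc_lt]
    rw [Equiv.sum_comp e (fun k : Fin m => if k.castSucc < p then 1 else 0)]
    have := Fin.card_Iio p
    rw [← Finset.filter_gt_eq_Iio, Finset.card_filter, Fin.sum_univ_castSucc] at this
    simpa [Fin.le_last, not_lt_of_ge] using this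
  unfold almostMinCount
  rw [Finset.card_filter, Fin.sum_univ_castSucc, hlast]
  simp only [hcast, Fin.val_castSucc, Fin.val_last, Finset.card_filter]

theorem sum_pow_almostMinCount {R : Type*} [CommSemiring R] (x : R) (q t : ℕ) :
    ∑ π : Perm (Fin (q + t)), x ^ almostMinCount q π =
      (q.factorial : R) * ∏ j ∈ Finset.range t, (q * x + (j + 1 : ℕ)) := by
  induction t with
  | zero =>
    have h (π : Perm (Fin (q + 0))) : almostMinCount q π = 0 := by
      simp only [almostMinCount, Finset.card_eq_zero, Finset.filter_eq_empty_iff]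
      intro i _ hi
      have := i.isLt
      omega
    simp [h, Fintype.card_perm]
  | succ t ih =>
    have hp : ∑ p : Fin (q + t + 1), x ^ (if q ≤ q + t ∧ (p : ℕ) < q then 1 else 0) =
        q * x + (t + 1 : ℕ) := by
      rw [Fin.sum_univ_eq_sum_range
        (fun p => x ^ (if q ≤ q + t ∧ p < q then 1 else 0)) (q + t + 1),
        add_assoc, Finset.sum_range_add]
      congr 1
      · rw [Finset.sum_congr rfl (g := fun _ => x)]
        · simp
        · intro i hi
          simp [Finset.mem_range.1 hi]
      · simp
    refine ((snocLast_bijective (q + t)).sum_comp (fun π => x ^ almostMinCount q π)).symm.trans ?_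
    rw [Fintype.sum_prod_type]
    simp only [almostMinCount_snocLast, pow_add]
    simp only [← Finset.sum_mul]
    rw [ih, ← Finset.mul_sum, hp, Finset.prod_range_succ, mul_assoc]

end Equiv.Perm

open Equiv.Perm

theorem cycleCount_eq {n : ℕ} (σ : Equiv.Perm (Fin n)) :
    cycleCount σ = σ.cycleType.card + (n - σ.cycleType.sum) := by
  rw [cycleCount, sum_cycleType]

theorem cycleCount_decomposeFin_symm {n : ℕ} (p : Fin (n + 1)) (e : Equiv.Perm (Fin n)) :
    cycleCount (decomposeFin.symm (p, e)) = cycleCount e + if p = 0 then 1 else 0 := by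
  have hn : e.cycleType.sum ≤ n := by simpa using e.sum_cycleType_le
  by_cases hp : p = 0
  · subst hp
    simp only [cycleCount_eq, cycleType_decomposeFin_symm_zero, if_true]
    omega
  · have h0 : decomposeFin.symm (p, e) 0 = p := by simp
    have h := cycleType_swap_mul (g := decomposeFin.symm (p, e)) (z := 0) (by rwa [h0])
    have hs : Equiv.swap 0 p * decomposeFin.symm (p, e) = decomposeFin.symm (0, e) := by
      rw [decomposeFin_symm_eq_swap_mul, Equiv.swap_mul_self_mul]
    rw [h0, hs, cycleType_decomposeFin_symm_zero] at h
    have h' : (decomposeFin.symm (p, e)).cycleType.sum ≤ n + 1 := by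
      simpa using (decomposeFin.symm (p, e)).sum_cycleType_le
    simp only [cycleCount_eq, if_neg hp]
    omega

theorem sum_pow_cycleCount {R : Type*} [CommSemiring R] (y : R) (n : ℕ) :
    ∑ σ : Equiv.Perm (Fin n), y ^ cycleCount σ = ∏ j ∈ Finset.range n, (y + (j : ℕ)) := by
  induction n with
  | zero => simp [cycleCount_eq, Subsingleton.elim _ (1 : Equiv.Perm (Fin 0))]
  | succ n ih =>
    rw [← Equiv.sum_comp decomposeFin.symm, Fintype.sum_prod_type]
    simp only [cycleCount_decomposeFin_symm, pow_add]
    simp only [← Finset.sum_mul]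
    rw [ih, ← Finset.mul_sum, Finset.prod_range_succ, Fin.sum_univ_succ]
    simp

theorem natPerm_val_succ {m : ℕ} (π : Equiv.Perm (Fin m)) (i : Fin m) :
    natPerm π (i + 1) = π i + 1 :=
  extendDomain_apply_image π (finIccEquiv m) i

theorem card_DelQ_natPerm {q m : ℕ} (hq : 0 < q) (π : Equiv.Perm (Fin m)) :
    (DelQ q m (natPerm π)).card = almostMinCount q π := by
  have hinj : Function.Injective fun i : Fin m => (i : ℕ) + 1 := fun a b h => by
    ext; simpa using h
  have hcount (i : Fin m) :
      #{j ∈ Finset.Ico 1 ((i : ℕ) + 1) | natPerm π j < natPerm π (i + 1)} =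
        #{j : Fin m | j < i ∧ π j < π i} := by
    rw [← Finset.card_image_of_injective _ hinj]
    congr 1
    ext j
    simp only [Finset.mem_filter, Finset.mem_Ico, Finset.mem_image, Finset.mem_univ, true_and]
    constructor
    · rintro ⟨⟨h1, h2⟩, h3⟩
      obtain ⟨j, rfl⟩ := Nat.exists_eq_add_of_le' h1
      have hj : j < i := by omega
      have h4 := natPerm_val_succ π ⟨j, hj.trans i.isLt⟩
      simp only at h4
      rw [h4, natPerm_val_succ] at h3
      exact ⟨⟨j, hj.trans i.isLt⟩, ⟨hj, by simpa using h3⟩, rfl⟩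
    · rintro ⟨j, ⟨h1, h2⟩, rfl⟩
      rw [natPerm_val_succ, natPerm_val_succ]
      exact ⟨⟨by omega, by simpa using h1⟩, by simpa using h2⟩
  rw [almostMinCount, ← Finset.card_image_of_injective _ hinj]
  congr 1
  ext i
  simp only [DelQ, Finset.mem_filter, Finset.mem_Icc, Finset.mem_image, Finset.mem_univ, true_and]
  constructor
  · rintro ⟨⟨h1, h2⟩, h3⟩
    obtain ⟨i, rfl⟩ := Nat.exists_eq_add_of_le' (show 1 ≤ i by omega)
    have := hcount ⟨i, h2⟩
    simp only at this
    rw [this] at h3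
    exact ⟨⟨i, h2⟩, ⟨by simpa using h1, by omega⟩, rfl⟩
  · rintro ⟨i, ⟨h1, h2⟩, rfl⟩
    rw [hcount]
    have := i.isLt
    exact ⟨by omega, by omega⟩

theorem coeff_sum_X_pow {ι : Type*} [Fintype ι] (f : ι → ℕ) (k : ℕ) :
    (∑ i, (Polynomial.X : Polynomial ℕ) ^ f i).coeff k = #{i | f i = k} := by
  simp [Polynomial.coeff_X_pow, eq_comm]

/-- For all positive integers `q`, `n` and every integer `k ≥ 1`,
`#{π ∈ S_{n+q-1} : #Del_q(π) = k-1} = q^k · (q-1)! · c(n,k)`. -/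
theorem count_by_delq (q n k : ℕ) (hq : 0 < q) (hn : 0 < n) (hk : 1 ≤ k) :
    {π : Equiv.Perm (Fin (n + q - 1)) |
        (DelQ q (n + q - 1) (natPerm π)).card = k - 1}.ncard =
      q ^ k * Nat.factorial (q - 1) * stirling1 n k := by
  obtain ⟨t, rfl⟩ : ∃ t, n = t + 1 := ⟨n - 1, by omega⟩
  obtain ⟨k, rfl⟩ : ∃ l, k = l + 1 := ⟨k - 1, by omega⟩
  obtain ⟨r, rfl⟩ : ∃ r, q = r + 1 := ⟨q - 1, by omega⟩
  rw [show t + 1 + (r + 1) - 1 = r + 1 + t by omega, Set.ncard_eq_toFinset_card']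
  simp only [Set.toFinset_ofPred, card_DelQ_natPerm hq, Nat.add_sub_cancel]
  have hpoly : (Polynomial.X : Polynomial ℕ) *
      ∑ π : Equiv.Perm (Fin (r + 1 + t)), Polynomial.X ^ almostMinCount (r + 1) π =
      (r.factorial : Polynomial ℕ) * ∑ σ : Equiv.Perm (Fin (t + 1)),
        (((r + 1 : ℕ) : Polynomial ℕ) * Polynomial.X) ^ cycleCount σ := by
    rw [sum_pow_almostMinCount, sum_pow_cycleCount, Finset.prod_range_succ',
      Nat.factorial_succ]
    push_cast
    ring
  have hstir : stirling1 (t + 1) (k + 1) =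
      #{σ : Equiv.Perm (Fin (t + 1)) | cycleCount σ = k + 1} := by
    rw [stirling1, Nat.card_eq_fintype_card, Fintype.card_subtype]
  have hcoeff := congrArg (fun p => p.coeff (k + 1)) hpoly
  rw [Polynomial.coeff_X_mul, coeff_sum_X_pow, Polynomial.coeff_natCast_mul,
    Polynomial.finsetSum_coeff] at hcoeff
  simp only [mul_pow, ← Nat.cast_pow, Polynomial.coeff_natCast_mul, Polynomial.coeff_X_pow,
    Nat.cast_id] at hcoeff
  rw [hcoeff, hstir, Finset.card_filter, Finset.mul_sum, Finset.mul_sum]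
  refine Finset.sum_congr rfl fun σ _ => ?_
  by_cases h : cycleCount σ = k + 1
  · simp [h, mul_comm]
  · simp [h, Ne.symm h]
end

section
/- For all positive integers q and n and all subsets B₁ ⊆ {q, q+1, …, n+q−1} and B₂ ⊆ {q, q+1, …, n+q−1}, the following identity holds in ℤ[t]: Σ_{π ∈ S_{n+q−1} : Des_q(π⁻¹) = B₁ and Del_q(π⁻¹) = B₂} t^{inv_q(π)} = Σ_{π ∈ S_{n+q−1} : Des_q(π⁻¹) = B₁ and Del_q(π⁻¹) = B₂} t^{rmaj_{q,n+q−1}(π)}. -/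
open Finset

/-- The (left, smaller) code of a permutation: the number of earlier smaller entries. -/
def code {m : ℕ} (π : Equiv.Perm (Fin m)) (i : ℕ) : ℕ :=
  if h : i < m then (univ.filter fun j : Fin m => j < ⟨i, h⟩ ∧ π j < π ⟨i, h⟩).card else 0

lemma code_fin {m : ℕ} (π : Equiv.Perm (Fin m)) (i : Fin m) :
    code π i = (univ.filter fun j : Fin m => j < i ∧ π j < π i).card := by
  simp [code]

lemma code_of_le {m : ℕ} (π : Equiv.Perm (Fin m)) {i : ℕ} (h : m ≤ i) : code π i = 0 := by
  simp [code, h.not_gt]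

lemma code_le {m : ℕ} (π : Equiv.Perm (Fin m)) (i : ℕ) : code π i ≤ i := by
  unfold code
  split_ifs with h
  · calc _ ≤ (Finset.Iio (⟨i, h⟩ : Fin m)).card := card_le_card fun j hj => by
          simp only [mem_filter] at hj
          simpa using hj.2.1
      _ = i := by simp
  · exact Nat.zero_le i

lemma code_inv_apply {m : ℕ} (π : Equiv.Perm (Fin m)) (i : Fin m) :
    code π⁻¹ (π i : Fin m) = code π i := by
  rw [code_fin, code_fin]
  refine (card_bij (fun j _ => π j) ?_ (fun _ _ _ _ h => π.injective h) ?_).symm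
  · intro j hj
    simpa [and_comm] using hj
  · intro u hu
    exact ⟨π⁻¹ u, by simpa [and_comm] using hu, by simp⟩

lemma code_last {m : ℕ} (π : Equiv.Perm (Fin (m + 1))) : code π m = π (Fin.last m) := by
  have h := code_fin π (Fin.last m)
  rw [Fin.val_last] at h
  rw [h, ← Fin.card_Iio (π (Fin.last m))]
  refine card_bij (fun j _ => π j) (fun j hj => ?_) (fun _ _ _ _ h => π.injective h) ?_
  · simp only [mem_filter] at hj
    simpa using hj.2.2
  · intro u hu
    refine ⟨π⁻¹ u, ?_, by simp⟩
    simp only [mem_Iio] at hu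
    simp only [mem_filter, mem_univ, true_and, Equiv.Perm.coe_inv, Equiv.apply_symm_apply, hu,
      and_true]
    refine Fin.lt_last_iff_ne_last.2 fun h => hu.ne ?_
    simp [← h]

/-- Append a last entry of rank `d` to a permutation. -/
def snocPerm {m : ℕ} (d : Fin (m + 1)) (π : Equiv.Perm (Fin m)) : Equiv.Perm (Fin (m + 1)) :=
  (finSuccEquiv' (Fin.last m)).trans ((Equiv.optionCongr π).trans (finSuccEquiv' d).symm)

lemma snocPerm_last {m : ℕ} (d : Fin (m + 1)) (π : Equiv.Perm (Fin m)) :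
    snocPerm d π (Fin.last m) = d := by
  simp [snocPerm]

lemma snocPerm_castSucc {m : ℕ} (d : Fin (m + 1)) (π : Equiv.Perm (Fin m)) (i : Fin m) :
    snocPerm d π i.castSucc = d.succAbove (π i) := by
  simp [snocPerm, finSuccEquiv'_last_apply_castSucc]

lemma snocPerm_bijective (m : ℕ) :
    Function.Bijective fun x : Equiv.Perm (Fin m) × Fin (m + 1) => snocPerm x.2 x.1 := by
  rw [Fintype.bijective_iff_injective_and_card]
  refine ⟨?_, by simp [Fintype.card_perm, Nat.factorial_succ, mul_comm]⟩
  rintro ⟨π, d⟩ ⟨ρ, d'⟩ h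
  simp only at h
  obtain rfl : d = d' := by rw [← snocPerm_last d π, h, snocPerm_last]
  obtain rfl : π = ρ := by
    ext1 i
    apply Fin.succAbove_right_injective (p := d)
    rw [← snocPerm_castSucc, ← snocPerm_castSucc, h]
  rfl

lemma sum_perm_succ {m : ℕ} {M : Type*} [AddCommMonoid M] (f : Equiv.Perm (Fin (m + 1)) → M) :
    ∑ π, f π = ∑ π : Equiv.Perm (Fin m), ∑ d : Fin (m + 1), f (snocPerm d π) := by
  rw [← Fintype.sum_prod_type', ← (snocPerm_bijective m).sum_comp]

lemma code_snocPerm {m : ℕ} (d : Fin (m + 1)) (π : Equiv.Perm (Fin m)) :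
    code (snocPerm d π) = Function.update (code π) m d := by
  ext i
  rcases lt_trichotomy i m with h | rfl | h
  · rw [Function.update_of_ne h.ne]
    have h1 := code_fin (snocPerm d π) (Fin.castSucc ⟨i, h⟩)
    have h2 := code_fin π ⟨i, h⟩
    simp only [Fin.val_castSucc] at h1 h2
    rw [h1, h2, card_filter, card_filter, Fin.sum_univ_castSucc]
    simp only [snocPerm_castSucc, (Fin.strictMono_succAbove d).lt_iff_lt,
      Fin.castSucc_lt_castSucc_iff, (Fin.castSucc_lt_last _).not_gt, false_and, if_false, add_zero]
  · rw [Function.update_self, code_last, snocPerm_last]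
  · rw [Function.update_of_ne h.ne', code_of_le _ h, code_of_le _ h.le]

/-- Insert the entry `d` at index `d` of a sequence. -/
def insertDiag (d : ℕ) (u : ℕ → ℕ) (i : ℕ) : ℕ :=
  if i < d then u i else if i = d then d else u (i - 1)

lemma code_snocPerm_inv {m : ℕ} (d : Fin (m + 1)) (π : Equiv.Perm (Fin m)) :
    code (snocPerm d π)⁻¹ = insertDiag d (code π⁻¹) := by
  ext i
  by_cases hi : i < m + 1
  · lift i to Fin (m + 1) using hi
    have hd := code_inv_apply (snocPerm d π) (Fin.last m)
    rw [snocPerm_last, Fin.val_last, code_last, snocPerm_last] at hd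
    rcases Fin.eq_self_or_eq_succAbove d i with rfl | ⟨v, rfl⟩
    · simp [hd, insertDiag]
    · obtain ⟨k, rfl⟩ := π.surjective v
      rw [← snocPerm_castSucc, code_inv_apply, code_snocPerm, snocPerm_castSucc,
        Fin.val_castSucc, Function.update_of_ne k.isLt.ne, ← code_inv_apply π]
      unfold insertDiag
      rcases lt_or_ge (π k).castSucc d with h | h
      · rw [Fin.succAbove_of_castSucc_lt _ _ h, Fin.val_castSucc, if_pos (by exact h)]
      · rw [Fin.succAbove_of_le_castSucc _ _ h]
        have h' : (d : ℕ) ≤ π k := h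
        rw [if_neg, if_neg] <;> simp <;> omega
  · have h := d.isLt
    rw [code_of_le _ (by omega), insertDiag, if_neg (by omega), if_neg (by omega),
      code_of_le _ (by omega)]

/-- Shift a sequence by `p` places and lower its entries by `p`, truncating at zero. -/
def shiftCode (p : ℕ) (e : ℕ → ℕ) (k : ℕ) : ℕ := e (k + p) - p

lemma shiftCode_update (p n d : ℕ) (e : ℕ → ℕ) :
    shiftCode p (Function.update e (n + p) d) = Function.update (shiftCode p e) n (d - p) := by
  ext k
  simp only [shiftCode, Function.update_apply]
  split_ifs <;> first | rfl | omega

lemma shiftCode_insertDiag (p d : ℕ) {u : ℕ → ℕ} (hu : ∀ i, u i ≤ i) :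
    shiftCode p (insertDiag d u) = insertDiag (d - p) (shiftCode p u) := by
  ext k
  have := hu (k + p - 1)
  simp only [shiftCode, insertDiag]
  split_ifs <;> try omega
  rw [show k + p - 1 = k - 1 + p by omega]

/-- The indices below `n` at which a sequence vanishes. -/
def zeroSet (n : ℕ) (e : ℕ → ℕ) : Finset ℕ := (range n).filter fun k => e k = 0

lemma mem_zeroSet {n : ℕ} {e : ℕ → ℕ} {k : ℕ} : k ∈ zeroSet n e ↔ k < n ∧ e k = 0 := by
  simp [zeroSet]

lemma card_zeroSet_update (n d : ℕ) (e : ℕ → ℕ) :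
    (zeroSet (n + 1) (Function.update e n d)).card =
      (zeroSet n e).card + if d = 0 then 1 else 0 := by
  simp only [zeroSet, card_filter, sum_range_succ, Function.update_self]
  congr 1
  refine sum_congr rfl fun k hk => ?_
  rw [Function.update_of_ne (mem_range.1 hk).ne]

lemma card_zeroSet_code_inv {n : ℕ} (π : Equiv.Perm (Fin n)) :
    (zeroSet n (code π⁻¹)).card = (zeroSet n (code π)).card := by
  simp only [zeroSet, card_filter, sum_range]
  rw [← Equiv.sum_comp π]
  simp only [code_inv_apply]

lemma sum_range_tsub {R : Type*} [CommSemiring R] (p n : ℕ) (f : ℕ → R) :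
    ∑ d ∈ range (n + p + 1), f (d - p) =
      ∑ d ∈ range (n + 1), (p + 1 : R) ^ (if d = 0 then 1 else 0) * f d := by
  induction n with
  | zero =>
    rw [zero_add, sum_congr rfl fun d hd => by
      rw [Nat.sub_eq_zero_of_le (Nat.lt_succ_iff.1 (mem_range.1 hd))]]
    simp
  | succ n ih =>
    rw [sum_range_succ _ (n + 1), ← ih, show n + 1 + p + 1 = (n + p + 1) + 1 by ring,
      sum_range_succ]
    simp [show n + p + 1 - p = n + 1 by omega]

/-- Summing over a permutation group a function of the shifted codes of `π` and `π⁻¹` amounts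
to a weighted sum over a smaller permutation group. -/
lemma sum_shiftCode {R : Type*} [CommSemiring R] (p n : ℕ) (F : (ℕ → ℕ) → (ℕ → ℕ) → R) :
    ∑ π : Equiv.Perm (Fin (n + p)), F (shiftCode p (code π)) (shiftCode p (code π⁻¹)) =
      (p.factorial : R) * ∑ τ : Equiv.Perm (Fin n),
        (p + 1 : R) ^ (zeroSet n (code τ)).card * F (code τ) (code τ⁻¹) := by
  induction n generalizing F with
  | zero =>
    have h0 : ∀ π : Equiv.Perm (Fin (0 + p)), shiftCode p (code π) = 0 := fun π => by
      ext k
      simp [shiftCode, code_of_le π (show 0 + p ≤ k + p by omega)]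
    have h1 : ∀ π : Equiv.Perm (Fin 0), code π = 0 := fun π => by
      ext k
      simp [code_of_le π k.zero_le]
    simp [h0, h1, zeroSet, Fintype.card_perm]
  | succ n ih =>
    rw [sum_perm_succ]
    have step : ∀ π : Equiv.Perm (Fin (n + p)),
        ∑ d : Fin (n + p + 1), F (shiftCode p (code (snocPerm d π)))
          (shiftCode p (code (snocPerm d π)⁻¹)) =
        ∑ d ∈ range (n + 1), (p + 1 : R) ^ (if d = 0 then 1 else 0) *
          F (Function.update (shiftCode p (code π)) n d)
            (insertDiag d (shiftCode p (code π⁻¹))) := fun π => by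
      rw [← sum_range_tsub p n fun d => F (Function.update (shiftCode p (code π)) n d)
        (insertDiag d (shiftCode p (code π⁻¹))), sum_range]
      refine sum_congr rfl fun d _ => ?_
      rw [code_snocPerm, code_snocPerm_inv, shiftCode_update,
        shiftCode_insertDiag _ _ (code_le _)]
    have reindex : ∑ π : Equiv.Perm (Fin (n + 1 + p)),
        F (shiftCode p (code π)) (shiftCode p (code π⁻¹)) =
        ∑ π : Equiv.Perm (Fin (n + p + 1)),
        F (shiftCode p (code π)) (shiftCode p (code π⁻¹)) := by
      rw [show n + 1 + p = n + p + 1 by ring]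
    rw [reindex, sum_perm_succ, sum_congr rfl fun π _ => step π,
      ih fun e u => ∑ d ∈ range (n + 1), (p + 1 : R) ^ (if d = 0 then 1 else 0) *
          F (Function.update e n d) (insertDiag d u)]
    congr 1
    refine sum_congr rfl fun τ _ => ?_
    rw [sum_range, mul_sum]
    refine sum_congr rfl fun d _ => ?_
    rw [code_snocPerm, code_snocPerm_inv, card_zeroSet_update, pow_add, mul_assoc]

section Foata

variable {α : Type*}

/-- Cut `a :: l` into blocks, each beginning with an entry satisfying `P`, and move the first
entry of each block to its end. -/
def rotBlocks (P : α → Prop) [DecidablePred P] : α → List α → List α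
  | a, [] => [a]
  | a, b :: l => if P b then a :: rotBlocks P b l else b :: rotBlocks P a l

lemma rotBlocks_perm (P : α → Prop) [DecidablePred P] (a : α) (l : List α) :
    (rotBlocks P a l).Perm (a :: l) := by
  induction l generalizing a with
  | nil => rfl
  | cons b l ih =>
    rw [rotBlocks]
    split_ifs
    · exact (ih b).cons a
    · exact ((ih a).cons b).trans (List.Perm.swap a b l)

lemma rotBlocks_filter (P : α → Prop) [DecidablePred P] {a : α} (ha : P a) (l : List α) :
    (rotBlocks P a l).filter P = (a :: l).filter P := by
  induction l generalizing a with
  | nil => rfl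
  | cons b l ih =>
    rw [rotBlocks]
    split_ifs with hb
    · simp_all
    · simp_all

lemma rotBlocks_filter_not (P : α → Prop) [DecidablePred P] {a : α} (ha : P a) (l : List α) :
    (rotBlocks P a l).filter (¬ P ·) = (a :: l).filter (¬ P ·) := by
  induction l generalizing a with
  | nil => rfl
  | cons b l ih =>
    rw [rotBlocks]
    split_ifs with hb
    · simp_all
    · simp_all

lemma rotBlocks_ne_nil (P : α → Prop) [DecidablePred P] (a : α) (l : List α) :
    rotBlocks P a l ≠ [] := by
  cases l with
  | nil => simp [rotBlocks]
  | cons b l => rw [rotBlocks]; split_ifs <;> simp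

lemma rotBlocks_getLast (P : α → Prop) [DecidablePred P] {a : α} (ha : P a) (l : List α) :
    P ((rotBlocks P a l).getLast (rotBlocks_ne_nil P a l)) := by
  induction l generalizing a with
  | nil => simpa [rotBlocks]
  | cons b l ih =>
    by_cases hb : P b
    · simp only [rotBlocks, hb, if_true]
      rw [List.getLast_cons (rotBlocks_ne_nil P b l)]
      exact ih hb
    · simp only [rotBlocks, hb, if_false]
      rw [List.getLast_cons (rotBlocks_ne_nil P a l)]
      exact ih ha

lemma rotBlocks_injective (P : α → Prop) [DecidablePred P] {a a' : α} (ha : P a) (ha' : P a')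
    {l l' : List α} (h : rotBlocks P a l = rotBlocks P a' l') : a :: l = a' :: l' := by
  induction l generalizing a a' l' with
  | nil =>
    cases l' with
    | nil => exact h
    | cons b' l' =>
      have := congrArg List.length h
      simp [(rotBlocks_perm P _ _).length_eq] at this
  | cons b l ih =>
    cases l' with
    | nil =>
      have := congrArg List.length h
      simp [(rotBlocks_perm P _ _).length_eq] at this
    | cons b' l' =>
      rw [rotBlocks, rotBlocks] at h
      split_ifs at h with hb hb' hb' <;> rw [List.cons.injEq] at h
      · rw [h.1, ih hb hb' h.2]
      · exact absurd (h.1 ▸ ha) hb'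
      · exact absurd (h.1 ▸ ha') hb
      · have := ih ha ha' h.2
        simp_all

lemma pair_sublist_filter {P : α → Prop} [DecidablePred P] {a b : α} (ha : P a) (hb : P b)
    (l : List α) : [a, b].Sublist (l.filter P) ↔ [a, b].Sublist l :=
  ⟨fun h => h.trans List.filter_sublist, fun h => by simpa [ha, hb] using h.filter P⟩

lemma pair_sublist_cons {x a b : α} {l : List α} :
    [a, b].Sublist (x :: l) ↔ (a = x ∧ b ∈ l) ∨ [a, b].Sublist l := by
  rw [List.sublist_cons_iff, or_comm]
  simp only [List.cons.injEq, ← List.singleton_sublist]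
  refine or_congr_left ⟨?_, ?_⟩
  · rintro ⟨r, ⟨rfl, rfl⟩, h⟩
    exact ⟨rfl, h⟩
  · rintro ⟨rfl, h⟩
    exact ⟨_, ⟨rfl, rfl⟩, h⟩

variable [LinearOrder α]

/-- The rotation used in Foata's bijection when the letter `x` is prepended. -/
def foataRot (x : α) : List α → List α
  | [] => []
  | a :: l => if a < x then rotBlocks (· < x) a l else rotBlocks (¬ · < x) a l

lemma foataRot_perm (x : α) (l : List α) : (foataRot x l).Perm l := by
  cases l with
  | nil => rfl
  | cons a l => rw [foataRot]; split_ifs <;> exact rotBlocks_perm _ _ _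

lemma foataRot_filter_lt (x : α) (l : List α) :
    (foataRot x l).filter (· < x) = l.filter (· < x) := by
  cases l with
  | nil => rfl
  | cons a l =>
    rw [foataRot]
    split_ifs with h
    · exact rotBlocks_filter (· < x) h l
    · simpa using rotBlocks_filter_not (¬ · < x) h l

lemma foataRot_filter_not_lt (x : α) (l : List α) :
    (foataRot x l).filter (¬ · < x) = l.filter (¬ · < x) := by
  cases l with
  | nil => rfl
  | cons a l =>
    rw [foataRot]
    split_ifs with h
    · exact rotBlocks_filter_not (· < x) h l
    · exact rotBlocks_filter (¬ · < x) h l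

lemma foataRot_injective (x : α) : Function.Injective (foataRot x) := by
  intro l l' h
  cases l with
  | nil =>
    have := foataRot_perm x l'
    rw [← h] at this
    exact (List.nil_perm.1 this).symm
  | cons a l =>
    cases l' with
    | nil =>
      have := foataRot_perm x (a :: l)
      rw [h] at this
      exact List.nil_perm.1 this
    | cons a' l' =>
      rw [foataRot, foataRot] at h
      split_ifs at h with ha ha' ha'
      · exact rotBlocks_injective (· < x) ha ha' h
      · have := rotBlocks_getLast (¬ · < x) ha' l'
        simp only [← h] at this
        exact absurd (rotBlocks_getLast (· < x) ha l) this
      · have := rotBlocks_getLast (¬ · < x) ha l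
        simp only [h] at this
        exact absurd (rotBlocks_getLast (· < x) ha' l') this
      · exact rotBlocks_injective (¬ · < x) ha ha' h

/-- Foata's second fundamental transformation, reading words from right to left. -/
def foata : List α → List α
  | [] => []
  | x :: l => x :: foataRot x (foata l)

lemma foata_perm (l : List α) : (foata l).Perm l := by
  induction l with
  | nil => rfl
  | cons x l ih => exact ((foataRot_perm x _).trans ih).cons x

lemma foata_injective : Function.Injective (foata (α := α)) := by
  intro l
  induction l with
  | nil =>
    intro l' h
    have := foata_perm l'
    rw [← h] at this
    exact (List.nil_perm.1 this).symm
  | cons x l ih =>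
    intro l' h
    cases l' with
    | nil => simp [foata] at h
    | cons x' l' =>
      simp only [foata, List.cons.injEq] at h
      obtain ⟨rfl, h⟩ := h
      rw [ih (foataRot_injective x h)]

/-- The number of inversions of a word. -/
def invList : List α → ℕ
  | [] => 0
  | x :: l => l.countP (· < x) + invList l

/-- The reverse major index of a word. -/
def rmajList : List α → ℕ
  | [] => 0
  | [_] => 0
  | x :: y :: l => (if y < x then l.length + 1 else 0) + rmajList (y :: l)

lemma invList_rotBlocks_lt (x a : α) (ha : a < x) (l : List α) :
    invList (rotBlocks (· < x) a l) = invList (a :: l) + l.countP (¬ · < x) := by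
  induction l generalizing a with
  | nil => simp [rotBlocks]
  | cons b l ih =>
    rw [rotBlocks]
    split_ifs with hb
    · rw [invList, (rotBlocks_perm _ b l).countP_eq, ih b hb]
      simp [invList, List.countP_cons, hb.not_ge]
      ring
    · rw [invList, (rotBlocks_perm _ a l).countP_eq, ih a ha]
      have h1 : a < b := ha.trans_le (not_lt.1 hb)
      simp [invList, h1, h1.not_gt, not_lt.1 hb]
      ring

lemma invList_rotBlocks_not_lt (x a : α) (ha : ¬ a < x) (l : List α) :
    invList (rotBlocks (¬ · < x) a l) + l.countP (· < x) = invList (a :: l) := by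
  induction l generalizing a with
  | nil => simp [rotBlocks]
  | cons b l ih =>
    rw [rotBlocks]
    split_ifs with hb
    · rw [invList, (rotBlocks_perm _ a l).countP_eq]
      have h1 : b < a := hb.trans_le (not_lt.1 ha)
      have h2 := ih a ha
      simp only [invList, List.countP_cons, decide_eq_true_eq, hb, h1, h1.not_gt, if_true,
        if_false] at h2 ⊢
      omega
    · rw [invList, (rotBlocks_perm _ b l).countP_eq, invList, ← ih b hb]
      simp [List.countP_cons, hb]
      ring

lemma head_foata (x : α) (l : List α) : ∃ l', foata (x :: l) = x :: l' := ⟨_, rfl⟩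

lemma invList_foata (l : List α) : invList (foata l) = rmajList l := by
  induction l with
  | nil => rfl
  | cons x l ih =>
    rw [foata, invList, (foataRot_perm x _).countP_eq]
    cases l with
    | nil => rfl
    | cons y l =>
      have hlen := (foata_perm (y :: l)).length_eq
      rw [rmajList, ← ih]
      obtain ⟨l', hl'⟩ := head_foata y l
      rw [hl'] at hlen ⊢
      rw [foataRot]
      split_ifs with h
      · rw [invList_rotBlocks_lt _ _ h]
        have := List.length_eq_countP_add_countP (fun z => decide (z < x)) (l := l')
        simp only [List.length_cons, Nat.add_right_cancel_iff] at hlen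
        simp [h, ← hlen, this]
        ring
      · rw [← invList_rotBlocks_not_lt x y h]
        simp [h]
        ring

lemma pair_sublist_foataRot {x a b : α} (hab : a < x ↔ b < x) (l : List α) :
    [a, b].Sublist (foataRot x l) ↔ [a, b].Sublist l := by
  by_cases ha : a < x
  · rw [← pair_sublist_filter (P := (· < x)) ha (hab.1 ha), foataRot_filter_lt,
      pair_sublist_filter (P := (· < x)) ha (hab.1 ha)]
  · have hb : ¬ b < x := fun h => ha (hab.2 h)
    rw [← pair_sublist_filter (P := (¬ · < x)) ha hb, foataRot_filter_not_lt,
      pair_sublist_filter (P := (¬ · < x)) ha hb]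

lemma pair_sublist_foata {a b : α} {l : List α} (hl : l.Nodup)
    (hab : ∀ x ∈ l, x ≠ a → x ≠ b → (a < x ↔ b < x)) :
    [a, b].Sublist (foata l) ↔ [a, b].Sublist l := by
  induction l with
  | nil => rfl
  | cons x l ih =>
    rw [List.nodup_cons] at hl
    have hx : x ∉ foata l := fun h => hl.1 ((foata_perm l).subset h)
    have hx' : x ∉ foataRot x (foata l) := fun h => hx ((foataRot_perm x _).subset h)
    have ih := ih hl.2 fun y hy => hab y (List.mem_cons_of_mem x hy)
    rw [foata, pair_sublist_cons, pair_sublist_cons, (foataRot_perm x _).mem_iff,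
      (foata_perm l).mem_iff]
    refine or_congr_right ?_
    by_cases h : x = a ∨ x = b
    · have key : ∀ l' : List α, x ∉ l' → ¬ [a, b].Sublist l' := fun l' hl' hs => by
        rcases h with rfl | rfl
        · exact hl' (hs.subset (by simp))
        · exact hl' (hs.subset (by simp))
      exact iff_of_false (key _ hx') (key _ hl.1)
    · push Not at h
      rw [pair_sublist_foataRot (hab x (by simp) h.1 h.2), ih]

lemma exists_pair_sublist_foata {b : α} {l : List α} (hl : l.Nodup) :
    (∃ a < b, [a, b].Sublist (foata l)) ↔ ∃ a < b, [a, b].Sublist l := by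
  induction l with
  | nil => rfl
  | cons x l ih =>
    rw [List.nodup_cons] at hl
    simp only [foata, pair_sublist_cons, (foataRot_perm x _).mem_iff, (foata_perm l).mem_iff]
    have hmem : ∀ {a} {l' : List α}, [a, b].Sublist l' → b ∈ l' := fun h => h.subset (by simp)
    have hm1 : b ∈ foataRot x (foata l) ↔ b ∈ l := by
      rw [(foataRot_perm x _).mem_iff, (foata_perm l).mem_iff]
    rcases lt_or_ge x b with h | h
    · by_cases hb : b ∈ l
      · exact iff_of_true ⟨x, h, .inl ⟨rfl, hb⟩⟩ ⟨x, h, .inl ⟨rfl, hb⟩⟩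
      · refine iff_of_false ?_ ?_
        · rintro ⟨a, -, h | h⟩
          exacts [hb h.2, hb (hm1.1 (hmem h))]
        · rintro ⟨a, -, h | h⟩
          exacts [hb h.2, hb (hmem h)]
    · have h1 : ∀ l' : List α,
          (∃ a < b, a = x ∧ b ∈ l ∨ [a, b].Sublist l') ↔ ∃ a < b, [a, b].Sublist l' := by
        refine fun l' => exists_congr fun a => and_congr_right fun ha => ?_
        simp [(ha.trans_le h).ne]
      rw [h1, h1, ← ih hl.2]
      rcases h.eq_or_lt with rfl | h
      · refine iff_of_false ?_ ?_
        · rintro ⟨a, -, h⟩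
          exact hl.1 (hm1.1 (hmem h))
        · rintro ⟨a, -, h⟩
          exact hl.1 ((foata_perm l).subset (hmem h))
      · refine exists_congr fun a => and_congr_right fun ha => ?_
        rw [pair_sublist_foataRot (iff_of_true (ha.trans h) h)]

end Foata

/-- The descent positions of a permutation with code `e`, shifted by one. -/
def desSet (n : ℕ) (e : ℕ → ℕ) : Finset ℕ := (range n).filter fun k => 1 ≤ k ∧ e k ≤ e (k - 1)

lemma mem_desSet {n : ℕ} {e : ℕ → ℕ} {k : ℕ} :
    k ∈ desSet n e ↔ k < n ∧ 1 ≤ k ∧ e k ≤ e (k - 1) := by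
  simp [desSet]

/-- The number of inversions of a permutation with code `e`. -/
def invCode (n : ℕ) (e : ℕ → ℕ) : ℕ := ∑ k ∈ range n, (k - e k)

/-- The reverse major index of a permutation with code `e`. -/
def rmajCode (n : ℕ) (e : ℕ → ℕ) : ℕ := ∑ k ∈ desSet n e, (n - k)

lemma code_succ_le_iff {m : ℕ} (σ : Equiv.Perm (Fin m)) {i : ℕ} (h : i + 1 < m) :
    code σ (i + 1) ≤ code σ i ↔ σ ⟨i + 1, h⟩ < σ ⟨i, by omega⟩ := by
  have h1 := code_fin σ ⟨i + 1, h⟩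
  have h2 := code_fin σ ⟨i, by omega⟩
  simp only at h1 h2
  rw [h1, h2]
  constructor
  · contrapose!
    intro hle
    have hlt : σ ⟨i, by omega⟩ < σ ⟨i + 1, h⟩ := hle.lt_of_ne fun he => by
      simpa using σ.injective he
    refine card_lt_card (ssubset_iff_of_subset (fun j hj => ?_) |>.2 ⟨⟨i, by omega⟩, ?_, ?_⟩)
    · simp only [mem_filter, mem_univ, true_and, Fin.lt_def] at hj ⊢
      rw [Fin.lt_def] at hlt
      omega
    · simp only [mem_filter, mem_univ, true_and]
      exact ⟨Fin.mk_lt_mk.2 i.lt_succ_self, hlt⟩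
    · simp
  · intro hlt
    refine card_le_card fun j hj => ?_
    simp only [mem_filter, mem_univ, true_and] at hj ⊢
    refine ⟨lt_of_le_of_ne ?_ ?_, hj.2.trans hlt⟩
    · have := hj.1
      rw [Fin.lt_def] at this
      rw [Fin.le_def]
      simp only at this ⊢
      omega
    · rintro rfl
      exact hj.2.not_gt hlt

lemma code_eq_zero_iff {m : ℕ} (σ : Equiv.Perm (Fin m)) (i : Fin m) :
    code σ i = 0 ↔ ¬ ∃ j < i, σ j < σ i := by
  rw [code_fin, card_eq_zero, filter_eq_empty_iff]
  simp

lemma pair_sublist_ofFn {n : ℕ} (τ : Equiv.Perm (Fin n)) (a b : Fin n) :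
    [a, b].Sublist (List.ofFn τ) ↔ τ⁻¹ a < τ⁻¹ b := by
  constructor
  · have : (List.ofFn τ).Pairwise fun a b => τ⁻¹ a < τ⁻¹ b := by
      rw [List.pairwise_ofFn]
      intro i j hij
      simpa using hij
    exact fun h => List.pairwise_iff_forall_sublist.1 this h
  · intro h
    have : (List.ofFn τ).Pairwise fun a b => [a, b].Sublist (List.ofFn τ) :=
      List.pairwise_iff_forall_sublist.2 id
    simpa using List.pairwise_ofFn.1 this h

lemma exists_perm_ofFn_eq {n : ℕ} {l : List (Fin n)} (hl : l.Nodup) (hn : l.length = n) :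
    ∃ τ : Equiv.Perm (Fin n), List.ofFn τ = l := by
  have hinj : Function.Injective fun i : Fin n => l.get (i.cast hn.symm) := fun i j hij => by
    simpa using List.nodup_iff_injective_get.1 hl hij
  refine ⟨Equiv.ofBijective _ (Finite.injective_iff_bijective.1 hinj), ?_⟩
  apply List.ext_getElem
  · simp [hn]
  · intro i h1 h2
    simp

lemma countP_ofFn_eq_card {α : Type*} {n : ℕ} (g : Fin n → α) (P : α → Prop) [DecidablePred P] :
    (List.ofFn g).countP P = (univ.filter fun i => P (g i)).card := by
  induction n with
  | zero => simp
  | succ n ih =>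
    rw [List.ofFn_succ, List.countP_cons, ih, card_filter, card_filter, Fin.sum_univ_succ,
      add_comm]
    simp

lemma invList_ofFn {α : Type*} [LinearOrder α] {n : ℕ} (g : Fin n → α) :
    invList (List.ofFn g) = ∑ k, (univ.filter fun j => j < k ∧ g k < g j).card := by
  induction n with
  | zero => simp [invList]
  | succ n ih =>
    rw [List.ofFn_succ, invList, ih, countP_ofFn_eq_card, Fin.sum_univ_succ]
    simp only [card_filter, Fin.sum_univ_succ, Fin.succ_pos, true_and, Fin.not_lt_zero, false_and,
      if_false, sum_const_zero, zero_add, Fin.succ_lt_succ_iff, sum_add_distrib]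

lemma rmajList_ofFn {α : Type*} [LinearOrder α] {n : ℕ} (g : Fin (n + 1) → α) :
    rmajList (List.ofFn g) = ∑ k : Fin n, if g k.succ < g k.castSucc then n - (k : ℕ) else 0 := by
  induction n with
  | zero => simp [rmajList]
  | succ n ih =>
    have h := ih fun i => g i.succ
    rw [List.ofFn_succ] at h
    rw [List.ofFn_succ, List.ofFn_succ, rmajList, h, Fin.sum_univ_succ]
    simp

lemma invCode_code {n : ℕ} (τ : Equiv.Perm (Fin n)) :
    invCode n (code τ) = invList (List.ofFn τ) := by
  rw [invCode, invList_ofFn, sum_range]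
  refine sum_congr rfl fun k _ => Nat.sub_eq_of_eq_add ?_
  rw [code_fin, ← card_union_of_disjoint, ← filter_or]
  · conv_lhs => rw [← Fin.card_Iio k]
    congr 1
    ext j
    simp only [mem_Iio, mem_filter, mem_univ, true_and, ← and_or_left]
    refine ⟨fun h => ⟨h, ?_⟩, And.left⟩
    exact lt_or_gt_of_ne fun he => h.ne' (τ.injective he)
  · exact disjoint_filter.2 fun j _ h1 h2 => h1.2.not_gt h2.2

lemma rmajCode_code {n : ℕ} (τ : Equiv.Perm (Fin n)) :
    rmajCode n (code τ) = rmajList (List.ofFn τ) := by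
  cases n with
  | zero => simp [rmajCode, desSet, rmajList]
  | succ n =>
    rw [rmajCode, desSet, rmajList_ofFn, sum_filter, sum_range_succ', sum_range]
    simp only [nonpos_iff_eq_zero, one_ne_zero, false_and, if_false, add_zero]
    refine sum_congr rfl fun k _ => ?_
    simp only [Nat.le_add_left, true_and, Nat.add_sub_cancel, Nat.add_sub_add_right]
    exact if_congr (code_succ_le_iff τ (Nat.succ_lt_succ k.isLt)) rfl rfl

lemma desSet_code_inv_congr {n : ℕ} {τ τ' : Equiv.Perm (Fin n)}
    (h : List.ofFn τ' = foata (List.ofFn τ)) :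
    desSet n (code τ'⁻¹) = desSet n (code τ⁻¹) := by
  refine filter_congr fun k hk => and_congr_right fun hk1 => ?_
  obtain ⟨i, rfl⟩ := Nat.exists_eq_add_of_le' hk1
  have hi := mem_range.1 hk
  rw [Nat.add_sub_cancel, code_succ_le_iff _ hi, code_succ_le_iff _ hi, ← pair_sublist_ofFn,
    ← pair_sublist_ofFn, h]
  refine pair_sublist_foata (List.nodup_ofFn.2 τ.injective) fun x _ h1 h2 => ?_
  simp only [Fin.lt_def, ne_eq, Fin.ext_iff] at h1 h2 ⊢
  omega

lemma zeroSet_code_inv_congr {n : ℕ} {τ τ' : Equiv.Perm (Fin n)}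
    (h : List.ofFn τ' = foata (List.ofFn τ)) :
    zeroSet n (code τ'⁻¹) = zeroSet n (code τ⁻¹) := by
  refine filter_congr fun k hk => ?_
  lift k to Fin n using mem_range.1 hk
  simp only [code_eq_zero_iff, ← pair_sublist_ofFn, h]
  rw [exists_pair_sublist_foata (List.nodup_ofFn.2 τ.injective)]

/-- Inversions and the reverse major index are equidistributed jointly with the descent set and
the left-to-right minima of the inverse. -/
lemma sum_invCode_eq_sum_rmajCode {R : Type*} [CommSemiring R] (n : ℕ) (x : R)
    (H : Finset ℕ → Finset ℕ → R) :
    ∑ τ : Equiv.Perm (Fin n),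
        H (desSet n (code τ⁻¹)) (zeroSet n (code τ⁻¹)) * x ^ invCode n (code τ) =
      ∑ τ : Equiv.Perm (Fin n),
        H (desSet n (code τ⁻¹)) (zeroSet n (code τ⁻¹)) * x ^ rmajCode n (code τ) := by
  have hex : ∀ τ : Equiv.Perm (Fin n), ∃ τ' : Equiv.Perm (Fin n),
      List.ofFn τ' = foata (List.ofFn τ) := fun τ =>
    exists_perm_ofFn_eq ((foata_perm _).nodup_iff.2 (List.nodup_ofFn.2 τ.injective))
      (by rw [(foata_perm _).length_eq, List.length_ofFn])
  choose Φ hΦ using hex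
  have hinj : Function.Injective Φ := fun τ τ' h => by
    apply DFunLike.coe_injective
    apply List.ofFn_injective
    apply foata_injective
    rw [← hΦ, ← hΦ, h]
  rw [← (Finite.injective_iff_bijective.1 hinj).sum_comp]
  refine sum_congr rfl fun τ _ => ?_
  rw [desSet_code_inv_congr (hΦ τ), zeroSet_code_inv_congr (hΦ τ), invCode_code, rmajCode_code,
    hΦ, invList_foata]

lemma natPerm_succ {m : ℕ} (σ : Equiv.Perm (Fin m)) {i : ℕ} (h : i < m) :
    natPerm σ (i + 1) = σ ⟨i, h⟩ + 1 :=
  Equiv.Perm.extendDomain_apply_image σ (finIccEquiv m) ⟨i, h⟩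

lemma card_natPerm_lt {m : ℕ} (σ : Equiv.Perm (Fin m)) {i : ℕ} (h : i < m) :
    ((Ico 1 (i + 1)).filter fun j => natPerm σ j < natPerm σ (i + 1)).card = code σ i := by
  have h1 := code_fin σ ⟨i, h⟩
  simp only at h1
  rw [h1]
  symm
  refine card_bij (fun (j : Fin m) _ => (j : ℕ) + 1) ?_ ?_ ?_
  · intro j hj
    simp only [mem_filter, mem_univ, true_and, Fin.lt_def] at hj
    rw [mem_filter, mem_Ico, natPerm_succ σ j.isLt, natPerm_succ σ h]
    simp only [Fin.eta]
    omega
  · intro j _ k _ hjk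
    exact Fin.ext (Nat.succ_injective hjk)
  · intro j hj
    rw [mem_filter, mem_Ico] at hj
    obtain ⟨k, rfl⟩ := Nat.exists_eq_add_of_le' hj.1.1
    have hk : k < m := by omega
    rw [natPerm_succ σ hk, natPerm_succ σ h] at hj
    refine ⟨⟨k, hk⟩, ?_, rfl⟩
    simp only [mem_filter, mem_univ, true_and, Fin.lt_def]
    omega

lemma card_natPerm_gt {m : ℕ} (σ : Equiv.Perm (Fin m)) {i : ℕ} (h : i < m) :
    ((Ico 1 (i + 1)).filter fun j => natPerm σ (i + 1) < natPerm σ j).card = i - code σ i := by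
  rw [← card_natPerm_lt σ h]
  refine Nat.eq_sub_of_add_eq ?_
  rw [← card_union_of_disjoint, ← filter_or]
  · rw [filter_true_of_mem fun j hj => ?_, Nat.card_Ico, Nat.add_sub_cancel]
    exact lt_or_gt_of_ne fun he => (mem_Ico.1 hj).2.ne' ((natPerm σ).injective he)
  · exact disjoint_filter.2 fun j _ h1 h2 => h1.not_gt h2

lemma DelQ_natPerm (p n : ℕ) (σ : Equiv.Perm (Fin (n + p))) :
    DelQ (p + 1) (n + p) (natPerm σ) =
      ((zeroSet n (shiftCode p (code σ))).filter (1 ≤ ·)).image (· + (p + 1)) := by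
  ext x
  simp only [DelQ, mem_zeroSet, shiftCode, mem_filter, mem_image, mem_Icc,
    Nat.add_sub_cancel]
  constructor
  · rintro ⟨hx, h⟩
    obtain ⟨k, rfl⟩ := Nat.exists_eq_add_of_le' (show p + 1 ≤ x by omega)
    rw [← add_assoc, card_natPerm_lt σ (by omega)] at h
    exact ⟨k, by omega, rfl⟩
  · rintro ⟨k, hk, rfl⟩
    rw [← add_assoc, card_natPerm_lt σ (by omega)]
    omega

lemma DesQ_natPerm (p n : ℕ) (σ : Equiv.Perm (Fin (n + p))) :
    DesQ (p + 1) (n + p) (natPerm σ) = (desSet n (shiftCode p (code σ))).image (· + p) := by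
  have key : ∀ k, 1 ≤ k → k < n → (natPerm σ (k + p + 1) < natPerm σ (k + p) ↔
      code σ (k + p) ≤ code σ (k - 1 + p)) := fun k h1 h2 => by
    obtain ⟨i, rfl⟩ := Nat.exists_eq_add_of_le' h1
    rw [show i + 1 + p = i + p + 1 by ring, natPerm_succ σ (show i + p + 1 < n + p by omega),
      natPerm_succ σ (show i + p < n + p by omega), Nat.add_sub_cancel,
      code_succ_le_iff σ (by omega), Fin.lt_def]
    omega
  ext x
  rw [DesQ, DelQ_natPerm]
  simp only [DesSet, mem_zeroSet, mem_desSet, shiftCode, mem_union, mem_inter, mem_filter, mem_image,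
    mem_Icc]
  constructor
  · rintro (⟨⟨hx, h⟩, hx'⟩ | ⟨_, ⟨k, hk, rfl⟩, rfl⟩)
    · obtain ⟨k, rfl⟩ := Nat.exists_eq_add_of_le' (show p ≤ x by omega)
      rw [key k (by omega) (by omega)] at h
      exact ⟨k, by omega, rfl⟩
    · exact ⟨k, by omega, by omega⟩
  · rintro ⟨k, hk, rfl⟩
    rcases le_or_gt (code σ (k + p)) p with h | h
    · exact .inr ⟨k + (p + 1), ⟨k, by omega, rfl⟩, by omega⟩
    · refine .inl ⟨⟨by omega, ?_⟩, by omega⟩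
      rw [key k (by omega) (by omega)]
      omega

lemma invQ_natPerm (p n : ℕ) (σ : Equiv.Perm (Fin (n + p))) :
    invQ (p + 1) (n + p) (natPerm σ) = invCode n (shiftCode p (code σ)) := by
  rw [invQ, invCode]
  cases n with
  | zero => simp
  | succ n =>
    rw [sum_range_succ', Nat.zero_sub, add_zero, ← Finset.Ico_succ_right_eq_Icc,
      sum_Ico_eq_sum_range]
    refine sum_congr (by congr 1; simp; omega) fun k hk => ?_
    have hk' := mem_range.1 hk
    rw [show p + 1 + 1 + k = k + 1 + p + 1 by ring, card_natPerm_gt σ (by omega), shiftCode]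
    have := code_le σ (k + 1 + p)
    omega

lemma rmajQ_natPerm (p n : ℕ) (σ : Equiv.Perm (Fin (n + p))) :
    rmajQ (p + 1) (n + p) (natPerm σ) = rmajCode n (shiftCode p (code σ)) := by
  rw [rmajQ, rmajCode, DesQ_natPerm, sum_image fun _ _ _ _ h => Nat.add_right_cancel h]
  exact sum_congr rfl fun k _ => by omega

lemma sum_filter_shiftCode {R : Type*} [CommSemiring R] (p n : ℕ) (x : R)
    (s : (ℕ → ℕ) → ℕ) (B₁ B₂ : Finset ℕ) :
    ∑ π ∈ univ.filter (fun π : Equiv.Perm (Fin (n + p)) =>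
        DesQ (p + 1) (n + p) (natPerm π⁻¹) = B₁ ∧ DelQ (p + 1) (n + p) (natPerm π⁻¹) = B₂),
        x ^ s (shiftCode p (code π)) =
      (p.factorial : R) * ∑ τ : Equiv.Perm (Fin n),
        ((p + 1 : R) ^ (zeroSet n (code τ⁻¹)).card *
          if (desSet n (code τ⁻¹)).image (· + p) = B₁ ∧
            ((zeroSet n (code τ⁻¹)).filter (1 ≤ ·)).image (· + (p + 1)) = B₂ then 1 else 0) *
          x ^ s (code τ) := by
  simp only [sum_filter, DesQ_natPerm, DelQ_natPerm]
  rw [sum_shiftCode p n fun e u => if (desSet n u).image (· + p) = B₁ ∧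
    ((zeroSet n u).filter (1 ≤ ·)).image (· + (p + 1)) = B₂ then x ^ s e else 0]
  simp only [card_zeroSet_code_inv, mul_assoc, ite_mul, one_mul, zero_mul]

/-- For all positive integers `q` and `n` and all subsets
`B₁, B₂ ⊆ {q,…,n+q-1}`, in `ℤ[t]`:
`Σ_{π : Des_q(π⁻¹)=B₁, Del_q(π⁻¹)=B₂} t^{inv_q(π)}
 = Σ_{π : Des_q(π⁻¹)=B₁, Del_q(π⁻¹)=B₂} t^{rmaj_{q,n+q-1}(π)}`. -/
theorem fs_equidistribution (q n : ℕ) (hq : 0 < q) (hn : 0 < n) (B₁ B₂ : Finset ℕ)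
    (hB₁ : B₁ ⊆ Finset.Icc q (n + q - 1)) (hB₂ : B₂ ⊆ Finset.Icc q (n + q - 1)) :
    (∑ π ∈ Finset.univ.filter (fun π : Equiv.Perm (Fin (n + q - 1)) =>
          DesQ q (n + q - 1) (natPerm π⁻¹) = B₁ ∧
          DelQ q (n + q - 1) (natPerm π⁻¹) = B₂),
        (Polynomial.X : Polynomial ℤ) ^ invQ q (n + q - 1) (natPerm π)) =
      ∑ π ∈ Finset.univ.filter (fun π : Equiv.Perm (Fin (n + q - 1)) =>
          DesQ q (n + q - 1) (natPerm π⁻¹) = B₁ ∧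
          DelQ q (n + q - 1) (natPerm π⁻¹) = B₂),
        (Polynomial.X : Polynomial ℤ) ^ rmajQ q (n + q - 1) (natPerm π) := by
  obtain ⟨p, rfl⟩ := Nat.exists_eq_add_of_le' hq
  rw [show n + (p + 1) - 1 = n + p by omega]
  simp only [invQ_natPerm, rmajQ_natPerm]
  rw [sum_filter_shiftCode p n _ (invCode n), sum_filter_shiftCode p n _ (rmajCode n)]
  rw [sum_invCode_eq_sum_rmajCode n Polynomial.X fun D Z =>
    (p + 1 : Polynomial ℤ) ^ Z.card * if D.image (· + p) = B₁ ∧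
      (Z.filter (1 ≤ ·)).image (· + (p + 1)) = B₂ then 1 else 0]
end
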